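/- arXiv:0711.3405 — 5 statements merged into one kernel-verified Lean document; each statement's English description precedes it below -/
import Mathlib

section
/- Let F be a finite field of odd cardinality q and let ε be a generator of the cyclic group F^×. Then every element g of GL₂(F) is conjugate in GL₂(F) to a matrix of at least one of the following four forms: S_a = [[a,0],[0,a]] with a ∈ F^×; T_a = [[a,0],[1,a]] with a ∈ F^×; U_{a,b} = [[a,0],[0,b]] with a,b ∈ F^× and a ≠ b; or V_{x,y} = [[x, εy],[y, x]] with x,y ∈ F and y ≠ 0. -/
open Matrix

section

variable {F : Type*} [Field F]

/-- A non-scalar `2 × 2` matrix is similar to the companion matrix of its characteristic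
polynomial. -/
theorem exists_mul_eq_mul_companion (M : Matrix (Fin 2) (Fin 2) F)
    (hM : ¬(M 0 1 = 0 ∧ M 1 0 = 0 ∧ M 0 0 = M 1 1)) :
    ∃ P : GL (Fin 2) F,
      M * (P : Matrix (Fin 2) (Fin 2) F) =
        (P : Matrix (Fin 2) (Fin 2) F) * !![0, -M.det; 1, M.trace] := by
  have cyclic : ∀ u v : F, u * (M 1 0 * u + M 1 1 * v) - (M 0 0 * u + M 0 1 * v) * v ≠ 0 →
      ∃ P : GL (Fin 2) F, M * (P : Matrix (Fin 2) (Fin 2) F) =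
        (P : Matrix (Fin 2) (Fin 2) F) * !![0, -M.det; 1, M.trace] := by
    intro u v huv
    refine ⟨GeneralLinearGroup.mkOfDetNeZero
      !![u, M 0 0 * u + M 0 1 * v; v, M 1 0 * u + M 1 1 * v] ?_, ?_⟩
    · rwa [det_fin_two_of]
    · ext i j
      fin_cases i <;> fin_cases j <;>
        simp [GeneralLinearGroup.mkOfDetNeZero, mul_apply, det_fin_two, trace_fin_two] <;> ring
  by_cases h10 : M 1 0 = 0
  · by_cases h01 : M 0 1 = 0
    · refine cyclic 1 1 fun h => hM ⟨h01, h10, ?_⟩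
      linear_combination -h + h10 - h01
    · exact cyclic 0 1 fun h => h01 (by linear_combination -h)
  · exact cyclic 1 0 fun h => h10 (by linear_combination h)

/-- Non-scalar elements of `GL₂` with the same trace and determinant are conjugate. -/
theorem exists_isConj_of_trace_eq_of_det_eq (g : GL (Fin 2) F) (M : Matrix (Fin 2) (Fin 2) F)
    (hg : ¬(g 0 1 = 0 ∧ g 1 0 = 0 ∧ g 0 0 = g 1 1))
    (hM : ¬(M 0 1 = 0 ∧ M 1 0 = 0 ∧ M 0 0 = M 1 1))
    (htrace : M.trace = (g : Matrix (Fin 2) (Fin 2) F).trace)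
    (hdet : M.det = (g : Matrix (Fin 2) (Fin 2) F).det) :
    ∃ h : GL (Fin 2) F, IsConj g h ∧ (h : Matrix (Fin 2) (Fin 2) F) = M := by
  obtain ⟨P, hP⟩ := exists_mul_eq_mul_companion _ hg
  obtain ⟨Q, hQ⟩ := exists_mul_eq_mul_companion M hM
  rw [htrace, hdet] at hQ
  refine ⟨(Q * P⁻¹) * g * (Q * P⁻¹)⁻¹, isConj_iff.2 ⟨Q * P⁻¹, rfl⟩, ?_⟩
  set C : Matrix (Fin 2) (Fin 2) F := !![0, -(g : Matrix (Fin 2) (Fin 2) F).det; 1,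
    (g : Matrix (Fin 2) (Fin 2) F).trace]
  have hC : (↑P⁻¹ : Matrix (Fin 2) (Fin 2) F) * (g * P) = C := by
    rw [hP, Units.inv_mul_cancel_left]
  calc ((Q * P⁻¹ * g * (Q * P⁻¹)⁻¹ : GL (Fin 2) F) : Matrix (Fin 2) (Fin 2) F)
      = Q * (↑P⁻¹ * (g * P)) * (↑Q⁻¹ : Matrix (Fin 2) (Fin 2) F) := by
        simp only [_root_.mul_inv_rev, inv_inv, Units.val_mul, Matrix.mul_assoc]
    _ = M := by rw [hC, ← hQ, Units.mul_inv_cancel_right]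

/-- If `ε` generates the units of a field, every non-square is `ε` times a square. -/
theorem exists_eq_mul_sq_of_not_isSquare (ε : Fˣ) (hε : ∀ u : Fˣ, u ∈ Subgroup.zpowers ε)
    {D : F} (hD : ¬IsSquare D) : ∃ s : F, s ≠ 0 ∧ D = ε * s ^ 2 := by
  have hD0 : D ≠ 0 := by
    rintro rfl
    exact hD IsSquare.zero
  obtain ⟨n, hn⟩ := Subgroup.mem_zpowers_iff.1 (hε (Units.mk0 D hD0))
  have hn' : D = ((ε ^ n : Fˣ) : F) := by rw [hn, Units.val_mk0]
  obtain ⟨k, rfl⟩ | ⟨k, rfl⟩ := Int.even_or_odd n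
  · exact absurd ⟨((ε ^ k : Fˣ) : F), by rw [hn', _root_.zpow_add, Units.val_mul]⟩ hD
  · refine ⟨((ε ^ k : Fˣ) : F), Units.ne_zero _, ?_⟩
    rw [hn', _root_.zpow_add, two_mul, _root_.zpow_add, _root_.zpow_one]
    push_cast
    ring

end

/-- Every element of `GL₂(F)`, for `F` a finite field of odd cardinality with `ε` a generator
of `Fˣ`, is conjugate to a matrix of one of the four forms `S_a`, `T_a`, `U_{a,b}`, `V_{x,y}`. -/
theorem conj_class_representatives {F : Type*} [Field F] [Fintype F]
    (hodd : Odd (Fintype.card F)) (ε : Fˣ) (hε : ∀ u : Fˣ, u ∈ Subgroup.zpowers ε)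
    (g : GL (Fin 2) F) :
    ∃ h : GL (Fin 2) F, IsConj g h ∧
      ((∃ a : Fˣ, (h : Matrix (Fin 2) (Fin 2) F) = !![(a : F), 0; 0, (a : F)]) ∨
       (∃ a : Fˣ, (h : Matrix (Fin 2) (Fin 2) F) = !![(a : F), 0; 1, (a : F)]) ∨
       (∃ a b : Fˣ, a ≠ b ∧ (h : Matrix (Fin 2) (Fin 2) F) = !![(a : F), 0; 0, (b : F)]) ∨
       (∃ x y : F, y ≠ 0 ∧ (h : Matrix (Fin 2) (Fin 2) F) = !![x, (ε : F) * y; y, x])) := by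
  have h2 : (2 : F) ≠ 0 := by
    refine Ring.two_ne_zero fun h => ?_
    have := FiniteField.even_card_iff_char_two.1 h
    have := Nat.odd_iff.1 hodd
    omega
  have hdet : (g : Matrix (Fin 2) (Fin 2) F).det ≠ 0 := g.det_ne_zero
  by_cases hg : g 0 1 = 0 ∧ g 1 0 = 0 ∧ g 0 0 = g 1 1
  · obtain ⟨h01, h10, h00⟩ := hg
    have ha : g 1 1 ≠ 0 := fun h => hdet (by rw [det_fin_two, h01, h]; ring)
    refine ⟨g, IsConj.refl g, Or.inl ⟨Units.mk0 _ ha, ?_⟩⟩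
    ext i j
    fin_cases i <;> fin_cases j <;> simp [h01, h10, h00]
  set t := (g : Matrix (Fin 2) (Fin 2) F).trace with ht
  set d := (g : Matrix (Fin 2) (Fin 2) F).det with hd
  by_cases hD : IsSquare (t ^ 2 - 4 * d)
  · obtain ⟨s, hs⟩ := hD
    have hprod : (t + s) / 2 * ((t - s) / 2) = d := by
      field_simp
      linear_combination hs
    have ha : (t + s) / 2 ≠ 0 := fun h => hdet (by rw [← hprod, h, zero_mul])
    have hb : (t - s) / 2 ≠ 0 := fun h => hdet (by rw [← hprod, h, mul_zero])
    by_cases hs0 : s = 0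
    · subst hs0
      obtain ⟨h, hconj, hh⟩ := exists_isConj_of_trace_eq_of_det_eq g
        !![(t + 0) / 2, 0; 1, (t + 0) / 2] hg (by simp)
        (by rw [trace_fin_two_of, ← ht]; field_simp; ring)
        (by rw [det_fin_two_of, ← hd, ← hprod]; ring)
      exact ⟨h, hconj, Or.inr (Or.inl ⟨Units.mk0 _ ha, hh⟩)⟩
    · have hab : (t + s) / 2 ≠ (t - s) / 2 := by
        intro h
        field_simp at h
        exact mul_ne_zero h2 hs0 (by linear_combination h)
      obtain ⟨h, hconj, hh⟩ := exists_isConj_of_trace_eq_of_det_eq g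
        !![(t + s) / 2, 0; 0, (t - s) / 2] hg (fun h => hab h.2.2)
        (by rw [trace_fin_two_of, ← ht]; field_simp; ring)
        (by rw [det_fin_two_of, ← hd, ← hprod]; ring)
      exact ⟨h, hconj, Or.inr (Or.inr (Or.inl
        ⟨Units.mk0 _ ha, Units.mk0 _ hb, fun h => hab (congrArg Units.val h), hh⟩))⟩
  · obtain ⟨s, hs0, hs⟩ := exists_eq_mul_sq_of_not_isSquare ε hε hD
    have hy : s / 2 ≠ 0 := div_ne_zero hs0 h2
    obtain ⟨h, hconj, hh⟩ := exists_isConj_of_trace_eq_of_det_eq g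
      !![t / 2, (ε : F) * (s / 2); s / 2, t / 2] hg (fun h => hy h.2.1)
      (by rw [trace_fin_two_of, ← ht]; field_simp; ring)
      (by rw [det_fin_two_of, ← hd]; field_simp; linear_combination hs)
    exact ⟨h, hconj, Or.inr (Or.inr (Or.inr ⟨t / 2, s / 2, hy, hh⟩))⟩
end

section
/- Let F be a finite field of odd cardinality q, let ε be a generator of F^×, and let x, y ∈ F with y ≠ 0. The conjugacy class in GL₂(F) of the matrix V_{x,y} = [[x, εy],[y, x]] has exactly q² − q elements. -/
open Matrix

/-- A generator of the unit group of a finite field of odd cardinality is not a square. -/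
lemma not_isSquare_of_forall_mem_zpowers {F : Type*} [Field F] [Fintype F]
    (hodd : Odd (Fintype.card F)) (ε : Fˣ) (hε : ∀ u : Fˣ, u ∈ Subgroup.zpowers ε) :
    ¬ IsSquare (ε : F) := by
  intro hsq
  have hchar : ringChar F ≠ 2 := by
    intro h
    have := FiniteField.even_card_iff_char_two.1 h
    rw [Nat.odd_iff] at hodd
    omega
  obtain ⟨a, ha⟩ := FiniteField.exists_nonsquare hchar
  have ha0 : a ≠ 0 := by
    rintro rfl
    exact ha (IsSquare.zero)
  obtain ⟨n, hn⟩ := Subgroup.mem_zpowers_iff.1 (hε (Units.mk0 a ha0))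
  apply ha
  have h : (ε : F) ^ n = a := by
    rw [← Units.val_zpow_eq_zpow_val, hn, Units.val_mk0]
  rw [← h]
  exact hsq.zpow n

/-- The conjugate of `!![x, e * y; y, x]` by `!![1, s; 0, t]`. -/
def affineConj {F : Type*} [Field F] (e x y : F) (p : F × Fˣ) : Matrix (Fin 2) (Fin 2) F :=
  !![x + p.1 * y, (e - p.1 ^ 2) * y / p.2; p.2 * y, x - p.1 * y]

lemma affineConj_injective {F : Type*} [Field F] (e x : F) {y : F} (hy : y ≠ 0) :
    Function.Injective (affineConj e x y) := by
  rintro ⟨s, t⟩ ⟨s', t'⟩ h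
  have h00 := congrFun (congrFun h 0) 0
  have h10 := congrFun (congrFun h 1) 0
  simp only [affineConj, of_apply, cons_val', cons_val_zero, cons_val_one, cons_val_fin_one,
    add_right_inj, mul_eq_mul_right_iff, hy, or_false, Units.val_inj] at h00 h10
  rw [h00, h10]

/-- If `e` is not a square, the conjugates of `!![x, e * y; y, x]` are its conjugates by the
matrices `!![1, s; 0, t]`. -/
lemma exists_conj_iff_mem_range_affineConj {F : Type*} [Field F] {e : F} (he : ¬ IsSquare e)
    (x y : F) (B : Matrix (Fin 2) (Fin 2) F) :
    (∃ u : GL (Fin 2) F, (↑u : Matrix (Fin 2) (Fin 2) F) * !![x, e * y; y, x] *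
        (↑u⁻¹ : Matrix (Fin 2) (Fin 2) F) = B) ↔ B ∈ Set.range (affineConj e x y) := by
  have conj_iff (u : GL (Fin 2) F) (A B : Matrix (Fin 2) (Fin 2) F) :
      (↑u : Matrix (Fin 2) (Fin 2) F) * A * (↑u⁻¹ : Matrix (Fin 2) (Fin 2) F) = B ↔
        (↑u : Matrix (Fin 2) (Fin 2) F) * A = B * (↑u : Matrix (Fin 2) (Fin 2) F) :=
    Units.mul_inv_eq_iff_eq_mul u
  simp only [conj_iff]
  constructor
  · rintro ⟨u, hu⟩
    have hD : (u : Matrix (Fin 2) (Fin 2) F).det ≠ 0 :=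
      ((Matrix.isUnit_iff_isUnit_det _).1 u.isUnit).ne_zero
    obtain ⟨a, b, c, d, hM⟩ : ∃ a b c d, (u : Matrix (Fin 2) (Fin 2) F) = !![a, b; c, d] :=
      ⟨_, _, _, _, Matrix.eta_fin_two _⟩
    rw [hM, Matrix.det_fin_two_of] at hD
    have ht : d ^ 2 - e * c ^ 2 ≠ 0 := by
      intro h
      by_cases hc : c = 0
      · subst hc
        have hd : d = 0 := by simpa using h
        simp [hd] at hD
      · exact he ⟨d / c, by field_simp; linear_combination -h⟩
    obtain ⟨D, hD'⟩ : ∃ D, a * d - b * c = D := ⟨_, rfl⟩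
    obtain ⟨T, hT⟩ : ∃ T, d ^ 2 - e * c ^ 2 = T := ⟨_, rfl⟩
    rw [hD'] at hD
    rw [hT] at ht
    refine ⟨⟨(b * d - a * c * e) / D, Units.mk0 (T / D) (div_ne_zero ht hD)⟩, ?_⟩
    have hentry : (e - ((b * d - a * c * e) / D) ^ 2) * y / (T / D) =
        (e * a ^ 2 - b ^ 2) * y / D := by
      field_simp
      subst hD' hT
      ring
    refine u.isUnit.mul_right_cancel (Eq.trans ?_ hu)
    rw [hM, affineConj, Units.val_mk0, hentry]
    ext i j
    fin_cases i <;> fin_cases j <;> simp [Matrix.mul_apply, Fin.sum_univ_two] <;>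
      field_simp <;> subst hD' hT <;> ring
  · rintro ⟨⟨s, t⟩, rfl⟩
    refine ⟨Matrix.GeneralLinearGroup.mkOfDetNeZero !![1, s; 0, (t : F)] (by simp), ?_⟩
    have ht : (t : F) ≠ 0 := t.ne_zero
    change !![1, s; 0, (t : F)] * _ = _ * !![1, s; 0, (t : F)]
    ext i j
    fin_cases i <;> fin_cases j <;> simp [affineConj, Matrix.mul_apply, Fin.sum_univ_two] <;>
      field_simp <;> ring

/-- For `F` a finite field of odd cardinality `q` and `ε` a generator of `Fˣ`, the conjugacy
class in `GL₂(F)` of `V_{x,y} = [[x, εy],[y, x]]` with `y ≠ 0` has `q² - q` elements. -/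
theorem card_conj_class_V {F : Type*} [Field F] [Fintype F]
    (hodd : Odd (Fintype.card F)) (ε : Fˣ) (hε : ∀ u : Fˣ, u ∈ Subgroup.zpowers ε)
    (x y : F) (hy : y ≠ 0) :
    Nat.card {B : Matrix (Fin 2) (Fin 2) F | ∃ u : GL (Fin 2) F,
        (↑u : Matrix (Fin 2) (Fin 2) F) * !![x, (ε : F) * y; y, x] *
          (↑u⁻¹ : Matrix (Fin 2) (Fin 2) F) = B} =
      Fintype.card F ^ 2 - Fintype.card F := by
  have hrange : {B : Matrix (Fin 2) (Fin 2) F | ∃ u : GL (Fin 2) F,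
      (↑u : Matrix (Fin 2) (Fin 2) F) * !![x, (ε : F) * y; y, x] *
        (↑u⁻¹ : Matrix (Fin 2) (Fin 2) F) = B} = Set.range (affineConj (ε : F) x y) :=
    Set.ext (exists_conj_iff_mem_range_affineConj
      (not_isSquare_of_forall_mem_zpowers hodd ε hε) x y)
  rw [hrange, Nat.card_range_of_injective (affineConj_injective _ x hy), Nat.card_prod,
    Nat.card_units, Nat.card_eq_fintype_card, Nat.mul_sub, mul_one, sq]
end

section
/- Let F be a finite field of odd cardinality q, let ε be a generator of F^×, and let x, y, x', y' ∈ F with y ≠ 0 and y' ≠ 0. The matrices V_{x,y} = [[x, εy],[y, x]] and V_{x',y'} = [[x', εy'],[y', x']] are conjugate in GL₂(F) if and only if x = x' and (y' = y or y' = −y). -/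
open Matrix

/-- Two `2 × 2` matrices over `F` are conjugate in `GL₂(F)` if one is carried to the other by
conjugation by an invertible matrix. -/
def MatrixConjInGL {F : Type*} [Field F] (A B : Matrix (Fin 2) (Fin 2) F) : Prop :=
  ∃ u : GL (Fin 2) F,
    (↑u : Matrix (Fin 2) (Fin 2) F) * A * (↑u⁻¹ : Matrix (Fin 2) (Fin 2) F) = B

/-- For `F` a finite field of odd cardinality, `ε` a generator of `Fˣ`, and `y, y' ≠ 0`, the
matrices `V_{x,y}` and `V_{x',y'}` are conjugate in `GL₂(F)` iff `x = x'` and `y' = ±y`. -/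
theorem V_conjugate_iff {F : Type*} [Field F] [Fintype F]
    (hodd : Odd (Fintype.card F)) (ε : Fˣ) (hε : ∀ u : Fˣ, u ∈ Subgroup.zpowers ε)
    (x y x' y' : F) (hy : y ≠ 0) (hy' : y' ≠ 0) :
    MatrixConjInGL !![x, (ε : F) * y; y, x] !![x', (ε : F) * y'; y', x'] ↔
      x = x' ∧ (y' = y ∨ y' = -y) := by
  have h2 : (2 : F) ≠ 0 := Ring.two_ne_zero fun h =>
    (Nat.not_even_iff_odd.2 hodd) (FiniteField.even_card_iff_char_two.1 h |> Nat.even_iff.2)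
  constructor
  · rintro ⟨u, hu⟩
    have ht := congrArg Matrix.trace hu
    have hd := congrArg Matrix.det hu
    rw [Matrix.trace_units_conj] at ht
    rw [Matrix.det_units_conj] at hd
    simp only [Matrix.trace_fin_two_of, Matrix.det_fin_two_of] at ht hd
    have hx : x = x' := mul_left_cancel₀ h2 (by linear_combination ht)
    subst hx
    exact ⟨rfl, sq_eq_sq_iff_eq_or_eq_neg.1
      (mul_left_cancel₀ ε.ne_zero (by linear_combination hd))⟩
  · rintro ⟨rfl, rfl | rfl⟩
    · exact ⟨1, by simp⟩
    · refine ⟨GeneralLinearGroup.mkOfDetNeZero !![1, 0; 0, -1] (by simp), ?_⟩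
      rw [Units.mul_inv_eq_iff_eq_mul]
      simp [GeneralLinearGroup.mkOfDetNeZero]
end

section
/- Let F be a finite field with q elements and let P = X² − aX + b ∈ F[X] be a monic quadratic polynomial with b ≠ 0. Then the number of elements g ∈ GL₂(F) whose characteristic polynomial equals P is: q² + q if P has two distinct roots in F; q² if P = (X − c)² for some c ∈ F^×; and q² − q if P is irreducible over F. In particular, this number is always at most q² + q. -/
open Matrix Polynomial

/-- The quadratics `X ^ 2 - a X + b` and `X ^ 2 - c X + d` agree iff their coefficients do. -/
lemma X_sq_sub_C_mul_X_add_C_inj {F : Type*} [Field F] {a b c d : F} :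
    (X ^ 2 - C a * X + C b : F[X]) = X ^ 2 - C c * X + C d ↔ a = c ∧ b = d := by
  refine ⟨fun h => ?_, by rintro ⟨rfl, rfl⟩; rfl⟩
  have h0 : b = d := by simpa using congrArg (eval 0) h
  have h1 := congrArg (eval 1) h
  simp only [eval_add, eval_sub, eval_mul, eval_pow, eval_X, eval_C] at h1
  exact ⟨by linear_combination h0 - h1, h0⟩

/-- Over a finite field, `y * z = t` has `q - 1` solutions, and `q` more if `t = 0`. -/
lemma sum_sum_ite_mul_eq {F : Type*} [Field F] [Fintype F] [DecidableEq F] (t : F) :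
    ∑ y : F, ∑ z : F, (if y * z = t then 1 else 0) =
      (Fintype.card F - 1) + if t = 0 then Fintype.card F else 0 := by
  have key : ∀ y ∈ Finset.univ.erase (0 : F), ∑ z : F, (if y * z = t then 1 else 0) = 1 := by
    intro y hy
    have hy0 : y ≠ 0 := Finset.ne_of_mem_erase hy
    have h : ∀ z, y * z = t ↔ z = y⁻¹ * t := fun z => (eq_inv_mul_iff_mul_eq₀ hy0).symm
    simp [h]
  rw [← Finset.sum_erase_add _ _ (Finset.mem_univ (0 : F)), Finset.sum_congr rfl key]
  simp [Finset.card_erase_of_mem, eq_comm (a := t)]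

/-- An invertible `2 × 2` matrix with characteristic polynomial `X ^ 2 - a X + b` is determined by
its entries `x`, `y`, `z` at `(0, 0)`, `(0, 1)`, `(1, 0)`, subject to
`y * z = -(x ^ 2 - a * x + b)`. -/
noncomputable def charpolyFiberEquiv {F : Type*} [Field F] (a b : F) (hb : b ≠ 0) :
    {g : GL (Fin 2) F |
      (↑g : Matrix (Fin 2) (Fin 2) F).charpoly = X ^ 2 - C a * X + C b} ≃
    {p : F × F × F // p.2.1 * p.2.2 = -(p.1 ^ 2 - a * p.1 + b)} where
  toFun g := ⟨(g.1.1 0 0, g.1.1 0 1, g.1.1 1 0), by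
    have h := g.2
    rw [Set.mem_ofPred_eq, charpoly_fin_two, X_sq_sub_C_mul_X_add_C_inj, trace_fin_two,
      det_fin_two] at h
    linear_combination -h.2 + g.1.1 0 0 * h.1⟩
  invFun p :=
    have hdet : det !![p.1.1, p.1.2.1; p.1.2.2, a - p.1.1] = b := by
      rw [det_fin_two_of]
      linear_combination -p.2
    ⟨GeneralLinearGroup.mkOfDetNeZero !![p.1.1, p.1.2.1; p.1.2.2, a - p.1.1] (by rwa [hdet]), by
      change (!![p.1.1, p.1.2.1; p.1.2.2, a - p.1.1]).charpoly = _
      rw [charpoly_fin_two, hdet, trace_fin_two_of, add_sub_cancel]⟩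
  left_inv g := by
    have h := g.2
    rw [Set.mem_ofPred_eq, charpoly_fin_two, X_sq_sub_C_mul_X_add_C_inj, trace_fin_two] at h
    apply Subtype.ext
    apply Units.ext
    have hentry : a - g.1.1 0 0 = g.1.1 1 1 := by rw [sub_eq_iff_eq_add', h.1]
    change !![g.1.1 0 0, g.1.1 0 1; g.1.1 1 0, a - g.1.1 0 0] = g.1.1
    rw [hentry]
    exact (eta_fin_two _).symm
  right_inv p := rfl

/-- The number of elements of `GL₂(F)` with characteristic polynomial `X ^ 2 - a X + b` in terms
of the number of roots of that polynomial. -/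
lemma card_charpolyFiber {F : Type*} [Field F] [Fintype F] [DecidableEq F] (a b : F)
    (hb : b ≠ 0) :
    Nat.card {g : GL (Fin 2) F |
        (↑g : Matrix (Fin 2) (Fin 2) F).charpoly = X ^ 2 - C a * X + C b} =
      Fintype.card F * (Fintype.card F - 1) +
        Finset.card {x : F | x ^ 2 - a * x + b = 0} * Fintype.card F := by
  rw [Nat.card_congr (charpolyFiberEquiv a b hb), Nat.card_eq_fintype_card,
    Fintype.card_subtype, Finset.card_filter, Fintype.sum_prod_type]
  simp only [Fintype.sum_prod_type, sum_sum_ite_mul_eq, neg_eq_zero, Finset.sum_add_distrib]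
  simp [← Finset.sum_filter]

/-- Let `F` be a finite field with `q` elements and `P = X² - aX + b` with `b ≠ 0`. The number
of `g ∈ GL₂(F)` with characteristic polynomial `P` is `q² + q` if `P` has two distinct roots in
`F`, `q²` if `P = (X - c)²` with `c ∈ Fˣ`, and `q² - q` if `P` is irreducible; in particular it
is always at most `q² + q`. -/
theorem card_fixed_charpoly {F : Type*} [Field F] [Fintype F] (a b : F) (hb : b ≠ 0) :
    (∀ c d : F, c ≠ d → X ^ 2 - C a * X + C b = (X - C c) * (X - C d) →
      Nat.card {g : GL (Fin 2) F |
          (↑g : Matrix (Fin 2) (Fin 2) F).charpoly = X ^ 2 - C a * X + C b} =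
        Fintype.card F ^ 2 + Fintype.card F) ∧
    (∀ c : F, c ≠ 0 → X ^ 2 - C a * X + C b = (X - C c) ^ 2 →
      Nat.card {g : GL (Fin 2) F |
          (↑g : Matrix (Fin 2) (Fin 2) F).charpoly = X ^ 2 - C a * X + C b} =
        Fintype.card F ^ 2) ∧
    (Irreducible (X ^ 2 - C a * X + C b) →
      Nat.card {g : GL (Fin 2) F |
          (↑g : Matrix (Fin 2) (Fin 2) F).charpoly = X ^ 2 - C a * X + C b} =
        Fintype.card F ^ 2 - Fintype.card F) ∧
    Nat.card {g : GL (Fin 2) F |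
        (↑g : Matrix (Fin 2) (Fin 2) F).charpoly = X ^ 2 - C a * X + C b} ≤
      Fintype.card F ^ 2 + Fintype.card F := by
  classical
  rw [card_charpolyFiber a b hb]
  have hq : Fintype.card F * (Fintype.card F - 1) + Fintype.card F = Fintype.card F ^ 2 := by
    obtain ⟨n, hn⟩ := Nat.exists_eq_succ_of_ne_zero (Fintype.card_ne_zero (α := F))
    rw [hn, Nat.succ_sub_one, Nat.succ_eq_add_one]
    ring
  have heval (x : F) : (X ^ 2 - C a * X + C b : F[X]).eval x = x ^ 2 - a * x + b := by simp
  refine ⟨fun c d hcd h => ?_, fun c _ h => ?_, fun h => ?_, ?_⟩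
  · have hroots : ({x : F | x ^ 2 - a * x + b = 0} : Finset F) = {c, d} := by
      ext x
      simp [← heval, h, sub_eq_zero]
    rw [hroots, Finset.card_pair hcd]
    omega
  · have hroots : ({x : F | x ^ 2 - a * x + b = 0} : Finset F) = {c} := by
      ext x
      simp [← heval, h, sub_eq_zero]
    rw [hroots, Finset.card_singleton]
    omega
  · have hdeg : (X ^ 2 - C a * X + C b : F[X]).natDegree = 2 := by compute_degree!
    have hroots : ({x : F | x ^ 2 - a * x + b = 0} : Finset F) = ∅ := by
      refine Finset.filter_eq_empty_iff.2 fun x _ hx => ?_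
      exact h.not_isRoot_of_natDegree_ne_one (by omega) ((heval x).trans hx)
    rw [hroots, Finset.card_empty]
    omega
  · have hdeg : (X ^ 2 - C a * X + C b : F[X]).natDegree = 2 := by compute_degree!
    have hne : (X ^ 2 - C a * X + C b : F[X]) ≠ 0 := ne_zero_of_natDegree_gt (n := 1) (by omega)
    have hle : Finset.card {x : F | x ^ 2 - a * x + b = 0} ≤ 2 := by
      refine (card_le_degree_of_subset_roots fun x hx => ?_).trans hdeg.le
      rw [mem_roots hne, IsRoot, heval]
      exact (Finset.mem_filter.1 hx).2
    have := Nat.mul_le_mul_right (Fintype.card F) hle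
    omega
end

section
/- Let F ⊆ E be finite fields with |F| = q > 3, let R ⊆ R̃ ⊆ E^× be subgroups, let H = {g ∈ GL₂(E) : g has all entries in F and det(g) ∈ R}, and let G be a subgroup of {g ∈ GL₂(E) : det(g) ∈ R̃} such that H is a normal subgroup of G. Then the quotient of G by its subgroup of scalar matrices G ∩ {sI : s ∈ E^×} is isomorphic as a group to PSL₂(F) or to PGL₂(F). -/
open Matrix

/-- The scalar matrix `s·I` as an element of `GL₂(E)`, for `s ∈ Eˣ`. -/
def scalarGL (E : Type*) [Field E] (s : Eˣ) : GL (Fin 2) E :=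
  Units.map (Matrix.scalar (Fin 2)).toMonoidHom s

/-- The subgroup of scalar matrices in `GL₂(E)`. -/
def scalarSubgroup (E : Type*) [Field E] : Subgroup (GL (Fin 2) E) :=
  MonoidHom.range (Units.map (Matrix.scalar (Fin 2)).toMonoidHom : Eˣ →* GL (Fin 2) E)

theorem scalarGL_mem_center (E : Type*) [Field E] (s : Eˣ) :
    scalarGL E s ∈ Subgroup.center (GL (Fin 2) E) := by
  rw [Subgroup.mem_center_iff]
  intro g
  apply Units.ext
  show (↑g : Matrix (Fin 2) (Fin 2) E) * Matrix.scalar (Fin 2) (s : E)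
      = Matrix.scalar (Fin 2) (s : E) * (↑g : Matrix (Fin 2) (Fin 2) E)
  exact (Matrix.scalar_commute (s : E) (fun r' => mul_comm _ _) _).eq.symm

instance scalarSubgroup_normal (E : Type*) [Field E] : (scalarSubgroup E).Normal := by
  constructor
  rintro x ⟨s, rfl⟩ g
  have h := (Subgroup.mem_center_iff.mp (scalarGL_mem_center E s) g).symm
  show g * scalarGL E s * g⁻¹ ∈ _
  rw [← h, mul_assoc, mul_inv_cancel, mul_one]
  exact ⟨s, rfl⟩

instance scalarSubgroupOf_normal (E : Type*) [Field E] (G : Subgroup (GL (Fin 2) E)) :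
    ((scalarSubgroup E).subgroupOf G).Normal := by
  constructor
  intro x hx g
  rw [Subgroup.mem_subgroupOf] at hx ⊢
  obtain ⟨s, hs⟩ := hx
  have hmem : (↑x : GL (Fin 2) E) ∈ Subgroup.center (GL (Fin 2) E) := by
    rw [← hs]; exact scalarGL_mem_center E s
  have hc : (↑(g * x * g⁻¹) : GL (Fin 2) E) = (↑x : GL (Fin 2) E) := by
    push_cast
    rw [Subgroup.mem_center_iff.mp hmem (↑g : GL (Fin 2) E),
      mul_assoc, mul_inv_cancel, mul_one]
  rw [hc]
  exact ⟨s, hs⟩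

/-- `PGL₂(K)`: the quotient of `GL₂(K)` by its subgroup of scalar matrices. -/
def PGL2 (K : Type*) [Field K] : Type _ := GL (Fin 2) K ⧸ scalarSubgroup K

noncomputable instance (K : Type*) [Field K] : Group (PGL2 K) :=
  QuotientGroup.Quotient.group (scalarSubgroup K)

/-- The subgroup `{±I}` of `SL₂(K)`. -/
def pmOne (K : Type*) [Field K] : Subgroup (Matrix.SpecialLinearGroup (Fin 2) K) :=
  Subgroup.zpowers (-1)

instance pmOne_normal (K : Type*) [Field K] : (pmOne K).Normal := by
  constructor
  intro x hx g
  obtain ⟨k, rfl⟩ := hx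
  have : g * (-1 : Matrix.SpecialLinearGroup (Fin 2) K) ^ k * g⁻¹
      = (-1 : Matrix.SpecialLinearGroup (Fin 2) K) ^ k := by
    have hcomm : Commute g ((-1 : Matrix.SpecialLinearGroup (Fin 2) K) ^ k) := by
      apply Commute.zpow_right
      simp [Commute, SemiconjBy]
    rw [hcomm.eq, mul_assoc, mul_inv_cancel, mul_one]
  rw [this]
  exact ⟨k, rfl⟩

/-- `PSL₂(K)`: the quotient of `SL₂(K)` by the subgroup `{±I}`. -/
def PSL2 (K : Type*) [Field K] : Type _ :=
  Matrix.SpecialLinearGroup (Fin 2) K ⧸ pmOne K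

noncomputable instance (K : Type*) [Field K] : Group (PSL2 K) :=
  QuotientGroup.Quotient.group (pmOne K)

theorem mem_scalarSubgroup_iff {K : Type*} [Field K] (g : GL (Fin 2) K) :
    g ∈ scalarSubgroup K ↔ (g : Matrix (Fin 2) (Fin 2) K) 0 1 = 0 ∧
      (g : Matrix (Fin 2) (Fin 2) K) 1 0 = 0 ∧
      (g : Matrix (Fin 2) (Fin 2) K) 0 0 = (g : Matrix (Fin 2) (Fin 2) K) 1 1 := by
  constructor
  · rintro ⟨s, rfl⟩
    simp [Matrix.scalar_apply]
  · rintro ⟨h01, h10, h⟩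
    have hdet : (g : Matrix (Fin 2) (Fin 2) K).det ≠ 0 :=
      (Matrix.GeneralLinearGroup.det g).ne_zero
    rw [Matrix.det_fin_two, h01, zero_mul, sub_zero] at hdet
    refine ⟨Units.mk0 _ (left_ne_zero_of_mul hdet), Units.ext ?_⟩
    ext i j
    fin_cases i <;> fin_cases j <;> simp [Matrix.scalar_apply, h01, h10, h]

theorem map_mem_scalarSubgroup_iff {K L : Type*} [Field K] [Field L] (f : K →+* L)
    (g : GL (Fin 2) K) :
    Matrix.GeneralLinearGroup.map f g ∈ scalarSubgroup L ↔ g ∈ scalarSubgroup K := by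
  simp [mem_scalarSubgroup_iff, f.injective.eq_iff]

theorem toGL_mem_scalarSubgroup_iff {K : Type*} [Field K]
    (x : Matrix.SpecialLinearGroup (Fin 2) K) :
    Matrix.SpecialLinearGroup.toGL x ∈ scalarSubgroup K ↔ x ∈ pmOne K := by
  rw [mem_scalarSubgroup_iff]
  constructor
  · rintro ⟨h01, h10, h⟩
    have hdet := x.det_coe
    change x.1 0 1 = 0 at h01
    change x.1 1 0 = 0 at h10
    change x.1 0 0 = x.1 1 1 at h
    rw [Matrix.det_fin_two, h01, zero_mul, sub_zero, h, mul_self_eq_one_iff] at hdet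
    rcases hdet with h1 | h1
    · refine ⟨0, Subtype.ext ?_⟩
      ext i j
      fin_cases i <;> fin_cases j <;> simp [h01, h10, h, h1]
    · refine ⟨1, Subtype.ext ?_⟩
      ext i j
      fin_cases i <;> fin_cases j <;> simp [h01, h10, h, h1]
  · intro hx
    obtain ⟨k, rfl⟩ := hx
    rcases Int.even_or_odd k with hk | hk
    · simp [hk.neg_one_zpow]
    · simp [hk.neg_one_zpow]

/-- Quotients of two groups by the kernels of homomorphisms with a common range are isomorphic. -/
theorem nonempty_quotient_mulEquiv_of_range_eq {A B Q : Type*} [Group A] [Group B] [Group Q]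
    (f : A →* Q) (g : B →* Q) (N : Subgroup A) (M : Subgroup B) [N.Normal] [M.Normal]
    (hf : N = f.ker) (hg : M = g.ker) (h : f.range = g.range) :
    Nonempty (A ⧸ N ≃* B ⧸ M) :=
  ⟨(QuotientGroup.quotientMulEquivOfEq hf).trans <|
    (QuotientGroup.quotientKerEquivRange f).trans <|
    (MulEquiv.subgroupCongr h).trans <|
    (QuotientGroup.quotientKerEquivRange g).symm.trans
      (QuotientGroup.quotientMulEquivOfEq hg.symm)⟩

/-- A matrix whose determinant is a square is a scalar matrix times a matrix of determinant `1`. -/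
theorem exists_toGL_mul_scalar_of_isSquare_det {K : Type*} [Field K] (h : GL (Fin 2) K)
    (hs : IsSquare (Matrix.GeneralLinearGroup.det h)) :
    ∃ (x : Matrix.SpecialLinearGroup (Fin 2) K) (z : GL (Fin 2) K),
      z ∈ scalarSubgroup K ∧ h = Matrix.SpecialLinearGroup.toGL x * z := by
  obtain ⟨u, hu⟩ := hs
  have hd : Matrix.GeneralLinearGroup.det (h * scalarGL K u⁻¹) = 1 := by
    have : Matrix.GeneralLinearGroup.det (scalarGL K u⁻¹) = u⁻¹ * u⁻¹ := by
      ext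
      simp [scalarGL, Matrix.scalar_apply, sq]
    rw [map_mul, this, hu]
    group
  let x : Matrix.SpecialLinearGroup (Fin 2) K :=
    ⟨(h * scalarGL K u⁻¹ : GL (Fin 2) K), congrArg Units.val hd⟩
  refine ⟨x, scalarGL K u, ⟨u, rfl⟩, ?_⟩
  have hx : Matrix.SpecialLinearGroup.toGL x = h * scalarGL K u⁻¹ := Units.ext rfl
  rw [hx, mul_assoc]
  simp only [scalarGL, map_inv, inv_mul_cancel, mul_one]

/-- In a finite field the product of two non-square units is a square. -/
theorem isSquare_mul_of_not_isSquare {K : Type*} [Field K] [Finite K] {a b : Kˣ}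
    (ha : ¬ IsSquare a) (hb : ¬ IsSquare b) : IsSquare (a * b) := by
  obtain ⟨g, hg⟩ := IsCyclic.exists_generator (α := Kˣ)
  obtain ⟨m, rfl⟩ := hg a
  obtain ⟨n, rfl⟩ := hg b
  have odd_of : ∀ k : ℤ, ¬ IsSquare (g ^ k) → Odd k := fun k hk => by
    rw [← Int.not_even_iff_odd]
    rintro ⟨r, rfl⟩
    exact hk ⟨g ^ r, zpow_add g r r⟩
  obtain ⟨r, hr⟩ := (odd_of m ha).add_odd (odd_of n hb)
  exact ⟨g ^ r, by simp only [← _root_.zpow_add, hr]⟩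

/-- If conjugation by `g` sends the matrices in `SL₂(F)` to matrices over `F`,
then `g` is a scalar multiple of a matrix over `F`. -/
theorem exists_map_mul_scalar_of_conj_mem {E : Type*} [Field E] (F : Subfield E)
    (g : GL (Fin 2) E)
    (hg : ∀ x : Matrix.SpecialLinearGroup (Fin 2) F, ∀ i j,
      (g * Matrix.GeneralLinearGroup.map F.subtype (Matrix.SpecialLinearGroup.toGL x) * g⁻¹ :
        GL (Fin 2) E).1 i j ∈ F) :
    ∃ (h : GL (Fin 2) F) (z : GL (Fin 2) E), z ∈ scalarSubgroup E ∧
      g = Matrix.GeneralLinearGroup.map F.subtype h * z := by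
  have hD : (g : Matrix (Fin 2) (Fin 2) E).det ≠ 0 :=
    (Matrix.GeneralLinearGroup.det g).ne_zero
  set D := (g : Matrix (Fin 2) (Fin 2) E).det with hDdef
  obtain ⟨a, ha⟩ : ∃ a, a = (g : Matrix (Fin 2) (Fin 2) E) 0 0 := ⟨_, rfl⟩
  obtain ⟨b, hb⟩ : ∃ a, a = (g : Matrix (Fin 2) (Fin 2) E) 0 1 := ⟨_, rfl⟩
  obtain ⟨c, hc⟩ : ∃ a, a = (g : Matrix (Fin 2) (Fin 2) E) 1 0 := ⟨_, rfl⟩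
  obtain ⟨d, hd⟩ : ∃ a, a = (g : Matrix (Fin 2) (Fin 2) E) 1 1 := ⟨_, rfl⟩
  have hDval : D = a * d - b * c := by rw [hDdef, Matrix.det_fin_two, ha, hb, hc, hd]
  have hgm : (g : Matrix (Fin 2) (Fin 2) E) = !![a, b; c, d] := by
    rw [ha, hb, hc, hd]; exact Matrix.eta_fin_two _
  have hgi : ((g⁻¹ : GL (Fin 2) E) : Matrix (Fin 2) (Fin 2) E) =
      D⁻¹ • !![d, -b; -c, a] := by
    rw [Matrix.coe_units_inv, Matrix.inv_def, hgm, Matrix.adjugate_fin_two_of, ← hgm,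
      Ring.inverse_eq_inv']
  have hconj : ∀ x : Matrix.SpecialLinearGroup (Fin 2) F, ∀ i j,
      (!![a, b; c, d] * x.1.map F.subtype * (D⁻¹ • !![d, -b; -c, a])) i j ∈ F := by
    intro x i j
    have := hg x i j
    rw [Units.val_mul, Units.val_mul, hgi, hgm] at this
    exact this
  let e : Matrix.SpecialLinearGroup (Fin 2) F := ⟨!![1, 1; 0, 1], by simp⟩
  let f : Matrix.SpecialLinearGroup (Fin 2) F := ⟨!![1, 0; 1, 1], by simp⟩
  let k : Matrix.SpecialLinearGroup (Fin 2) F :=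
    ⟨!![1 + 1, 1; 1, 1], by simp [Matrix.det_fin_two]⟩
  have he := hconj e
  have hf := hconj f
  have hk := hconj k
  rw [show e.1.map F.subtype = !![1, 1; 0, 1] by
    ext i j; fin_cases i <;> fin_cases j <;> simp [e]] at he
  rw [show f.1.map F.subtype = !![1, 0; 1, 1] by
    ext i j; fin_cases i <;> fin_cases j <;> simp [f]] at hf
  rw [show k.1.map F.subtype = !![1 + 1, 1; 1, 1] by
    ext i j; fin_cases i <;> fin_cases j <;> simp [k]] at hk
  clear_value D
  have haa : a * a * D⁻¹ ∈ F := by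
    convert he 0 1 using 1
    simp [Matrix.mul_apply, Fin.sum_univ_two]
    ring
  have hbb : b * b * D⁻¹ ∈ F := by
    convert F.neg_mem (hf 0 1) using 1
    simp [Matrix.mul_apply, Fin.sum_univ_two]
    ring
  have hac : a * c * D⁻¹ ∈ F := by
    convert F.sub_mem F.one_mem (he 0 0) using 1
    simp [Matrix.mul_apply, Fin.sum_univ_two]
    field_simp
    rw [hDval]
    ring
  have hbd : b * d * D⁻¹ ∈ F := by
    convert F.sub_mem (hf 0 0) F.one_mem using 1
    simp [Matrix.mul_apply, Fin.sum_univ_two]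
    field_simp
    rw [hDval]
    ring
  have hab : a * b * D⁻¹ ∈ F := by
    convert F.sub_mem (F.sub_mem haa hbb) (hk 0 1) using 1
    simp [Matrix.mul_apply, Fin.sum_univ_two]
    ring
  have had : a * d * D⁻¹ ∈ F := by
    convert F.sub_mem (F.add_mem (F.sub_mem (hk 0 0) F.one_mem) hac) hbd using 1
    simp [Matrix.mul_apply, Fin.sum_univ_two]
    field_simp
    rw [hDval]
    ring
  have hbc : b * c * D⁻¹ ∈ F := by
    convert F.sub_mem had F.one_mem using 1
    field_simp
    rw [hDval]
    ring
  have of_ratios : ∀ x : E, x ≠ 0 → a * x⁻¹ ∈ F → b * x⁻¹ ∈ F → c * x⁻¹ ∈ F → d * x⁻¹ ∈ F →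
      ∃ (h : GL (Fin 2) F) (z : GL (Fin 2) E), z ∈ scalarSubgroup E ∧
        g = Matrix.GeneralLinearGroup.map F.subtype h * z := by
    intro x hx h1 h2 h3 h4
    have hdet : (!![⟨a * x⁻¹, h1⟩, ⟨b * x⁻¹, h2⟩; ⟨c * x⁻¹, h3⟩, ⟨d * x⁻¹, h4⟩] :
        Matrix (Fin 2) (Fin 2) F).det ≠ 0 := by
      intro h0
      have h0' := congrArg F.subtype h0
      simp [Matrix.det_fin_two] at h0'
      refine hD ?_
      field_simp at h0'
      rw [hDval, h0', mul_zero]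
    refine ⟨Matrix.GeneralLinearGroup.mkOfDetNeZero _ hdet, scalarGL E (Units.mk0 x hx),
      ⟨_, rfl⟩, Units.ext ?_⟩
    rw [Units.val_mul, hgm]
    ext i j
    fin_cases i <;> fin_cases j <;>
      simp [scalarGL, Matrix.scalar_apply, Matrix.GeneralLinearGroup.mkOfDetNeZero, hx]
  have ratio : ∀ x y : E, x ≠ 0 → x * x * D⁻¹ ∈ F → y * x * D⁻¹ ∈ F → y * x⁻¹ ∈ F := by
    intro x y hx h1 h2
    convert F.div_mem h2 h1 using 1
    field_simp
  by_cases h0 : a = 0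
  · have hb0 : b ≠ 0 := by
      rintro rfl
      simp [hDval, h0] at hD
    exact of_ratios b hb0 (ratio b a hb0 hbb hab) (ratio b b hb0 hbb hbb)
      (ratio b c hb0 hbb (mul_comm b c ▸ hbc)) (ratio b d hb0 hbb (mul_comm b d ▸ hbd))
  · exact of_ratios a h0 (ratio a a h0 haa haa) (ratio a b h0 haa (mul_comm a b ▸ hab))
      (ratio a c h0 haa (mul_comm a c ▸ hac)) (ratio a d h0 haa (mul_comm a d ▸ had))

/-- Let `F ⊆ E` be finite fields with `|F| > 3`, let `R ⊆ R̃ ⊆ Eˣ` be subgroups, let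
`H = {g ∈ GL₂(E) : g has entries in F, det g ∈ R}` and let `G ≤ {g ∈ GL₂(E) : det g ∈ R̃}`
be a subgroup in which `H` is normal. Then `G` modulo its subgroup of scalar matrices is
isomorphic to `PSL₂(F)` or to `PGL₂(F)`. -/
theorem quotient_by_scalars_isom_PSL_or_PGL {E : Type*} [Field E] [Fintype E]
    (F : Subfield E) (hF : 3 < Nat.card F) (R Rt : Subgroup Eˣ) (hRRt : R ≤ Rt)
    (H G : Subgroup (GL (Fin 2) E))
    (hH : ∀ g : GL (Fin 2) E, g ∈ H ↔
      ((∀ i j, (↑g : Matrix (Fin 2) (Fin 2) E) i j ∈ F) ∧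
        Matrix.GeneralLinearGroup.det g ∈ R))
    (hG : ∀ g ∈ G, Matrix.GeneralLinearGroup.det g ∈ Rt)
    (hHG : H ≤ G) (hnorm : (H.subgroupOf G).Normal) :
    Nonempty ((G ⧸ (scalarSubgroup E).subgroupOf G) ≃* PSL2 F) ∨
    Nonempty ((G ⧸ (scalarSubgroup E).subgroupOf G) ≃* PGL2 F) := by
  let π : GL (Fin 2) E →* GL (Fin 2) E ⧸ scalarSubgroup E := QuotientGroup.mk' _
  let ι : GL (Fin 2) F →* GL (Fin 2) E := Matrix.GeneralLinearGroup.map F.subtype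
  let σ : Matrix.SpecialLinearGroup (Fin 2) F →* GL (Fin 2) F := Matrix.SpecialLinearGroup.toGL
  have π_eq_one : ∀ g, π g = 1 ↔ g ∈ scalarSubgroup E := QuotientGroup.eq_one_iff
  have π_ι_eq_one : ∀ h, π (ι h) = 1 ↔ h ∈ scalarSubgroup F := fun h =>
    (π_eq_one _).trans (map_mem_scalarSubgroup_iff F.subtype h)
  have ι_σ_mem_H : ∀ x, ι (σ x) ∈ H := fun x => by
    refine (hH _).2 ⟨fun i j => (x.1 i j).2, ?_⟩
    convert R.one_mem
    ext
    have := congrArg F.subtype x.det_coe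
    rw [RingHom.map_det, map_one] at this
    exact this
  have conj_mem : ∀ g ∈ G, ∀ h ∈ H, g * h * g⁻¹ ∈ H := fun g hg h hh =>
    hnorm.conj_mem ⟨h, hHG hh⟩ hh ⟨g, hg⟩
  have G_le : ∀ g ∈ G, ∃ h, π (ι h) = π g := fun g hg => by
    obtain ⟨h, z, hz, rfl⟩ := exists_map_mul_scalar_of_conj_mem F g fun x =>
      ((hH _).1 (conj_mem g hg _ (ι_σ_mem_H x))).1
    exact ⟨h, by rw [map_mul, (π_eq_one z).2 hz, mul_one]⟩
  have lift_square : ∀ h, IsSquare (Matrix.GeneralLinearGroup.det h) →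
      ∃ x, π (ι (σ x)) = π (ι h) := fun h hs => by
    obtain ⟨x, z, hz, rfl⟩ := exists_toGL_mul_scalar_of_isSquare_det h hs
    exact ⟨x, by rw [map_mul, map_mul, (π_ι_eq_one z).2 hz, mul_one]⟩
  have hkerG : (scalarSubgroup E).subgroupOf G = (π.comp G.subtype).ker := by
    ext g
    exact (π_eq_one g).symm
  by_cases hsq : ∀ g ∈ G, ∀ h, π (ι h) = π g → IsSquare (Matrix.GeneralLinearGroup.det h)
  · left
    refine nonempty_quotient_mulEquiv_of_range_eq (π.comp G.subtype) (π.comp (ι.comp σ)) _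
      (pmOne F) hkerG ?_ (le_antisymm ?_ ?_)
    · ext x
      exact (toGL_mem_scalarSubgroup_iff x).symm.trans (π_ι_eq_one _).symm
    · rintro _ ⟨⟨g, hg⟩, rfl⟩
      obtain ⟨h, hh⟩ := G_le g hg
      obtain ⟨x, hx⟩ := lift_square h (hsq g hg h hh)
      exact ⟨x, hx.trans hh⟩
    · rintro _ ⟨x, rfl⟩
      exact ⟨⟨_, hHG (ι_σ_mem_H x)⟩, rfl⟩
  · right
    push Not at hsq
    obtain ⟨g₀, hg₀, h₀, hh₀, hns⟩ := hsq
    refine nonempty_quotient_mulEquiv_of_range_eq (π.comp G.subtype) (π.comp ι) _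
      (scalarSubgroup F) hkerG ?_ (le_antisymm ?_ ?_)
    · ext h
      exact (π_ι_eq_one h).symm
    · rintro _ ⟨⟨g, hg⟩, rfl⟩
      exact G_le g hg
    · rintro _ ⟨h, rfl⟩
      by_cases hs : IsSquare (Matrix.GeneralLinearGroup.det h)
      · obtain ⟨x, hx⟩ := lift_square h hs
        exact ⟨⟨_, hHG (ι_σ_mem_H x)⟩, hx⟩
      · obtain ⟨x, hx⟩ := lift_square (h * h₀)
          (by rw [map_mul]; exact isSquare_mul_of_not_isSquare hs hns)
        refine ⟨⟨_, G.mul_mem (hHG (ι_σ_mem_H x)) (G.inv_mem hg₀)⟩, ?_⟩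
        change π (ι (σ x) * g₀⁻¹) = π (ι h)
        rw [map_mul, hx, map_inv, ← hh₀, map_mul, map_mul, mul_inv_cancel_right]
end
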